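/- For every positive integer n there exists a prime number p satisfying n < p < (9n+63)/8. -/

import Mathlib

open Finset Real
open scoped Chebyshev Nat ArithmeticFunction.vonMangoldt

/-- The linear combination `∑ wᵢ f(dᵢ)` encoded by the list of pairs `(dᵢ, wᵢ)`. -/
def combination {R : Type*} [Ring R] (W : List (ℕ × ℤ)) (f : ℕ → R) : R :=
  (W.map fun p ↦ (p.2 : R) * f p.1).sum

@[simp] theorem combination_nil {R : Type*} [Ring R] (f : ℕ → R) : combination [] f = 0 := rfl

@[simp] theorem combination_cons {R : Type*} [Ring R] (p : ℕ × ℤ) (W : List (ℕ × ℤ))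
    (f : ℕ → R) : combination (p :: W) f = p.2 * f p.1 + combination W f := by
  simp [combination]

theorem combination_congr {R : Type*} [Ring R] {W : List (ℕ × ℤ)} {f g : ℕ → R}
    (h : ∀ p ∈ W, f p.1 = g p.1) : combination W f = combination W g := by
  unfold combination
  congr 1
  exact List.map_congr_left fun p hp ↦ by rw [h p hp]

theorem combination_add {R : Type*} [Ring R] (W : List (ℕ × ℤ)) (f g : ℕ → R) :
    combination W (fun d ↦ f d + g d) = combination W f + combination W g := by
  induction W with
  | nil => simp
  | cons p W ih => simp only [combination_cons, ih]; noncomm_ring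

theorem combination_sum_mul (W : List (ℕ × ℤ)) (s : Finset ℕ) (c : ℕ → ℝ) (f : ℕ → ℕ → ℤ) :
    combination W (fun d ↦ ∑ k ∈ s, c k * f k d) =
      ∑ k ∈ s, c k * (combination W (f k) : ℤ) := by
  induction W with
  | nil => simp
  | cons p W ih =>
    simp only [combination_cons, ih, mul_sum, ← sum_add_distrib]
    refine sum_congr rfl fun k _ ↦ ?_
    push_cast
    ring

theorem log_factorial_div_eq_sum {n d : ℕ} :
    log (n / d)! = ∑ k ∈ Ioc 0 n, Λ k * ((n / k / d : ℕ) : ℤ) := by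
  have h : log (n / d)! = ∑ k ∈ Ioc 0 (n / d), Λ k * ((n / d / k : ℕ) : ℝ) := by
    rw [← ArithmeticFunction.sum_Ioc_mul_zeta_eq_sum, ArithmeticFunction.vonMangoldt_mul_zeta]
    induction n / d with
    | zero => simp
    | succ m ih =>
      rw [Nat.factorial_succ, Nat.cast_mul, log_mul (by positivity) (by positivity), ih,
        ← insert_Ioc_right_eq_Ioc_add_one (Nat.zero_le m), sum_insert (by simp)]
      simp
  rw [h]
  refine (sum_subset (Ioc_subset_Ioc_right (Nat.div_le_self n d)) fun k hk hk' ↦ ?_).trans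
    (sum_congr rfl fun k _ ↦ ?_)
  · rw [Nat.div_eq_of_lt (by simp at hk hk'; omega)]
    simp
  · rw [Nat.div_div_eq_div_mul, Nat.div_div_eq_div_mul, mul_comm d k, Int.cast_natCast]

theorem psi_div_eq_sum {n m : ℕ} (hm : 0 < m) :
    ψ (n / m : ℕ) = ∑ k ∈ Ioc 0 n, Λ k * ((if m ≤ n / k then 1 else 0 : ℤ) : ℤ) := by
  rw [Chebyshev.psi, Nat.floor_natCast]
  simp only [Int.cast_ite, Int.cast_one, Int.cast_zero, mul_ite, mul_one, mul_zero,
    ← sum_filter]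
  refine sum_congr ?_ fun _ _ ↦ rfl
  ext k
  simp only [mem_Ioc, mem_filter]
  constructor
  · rintro ⟨h0, h⟩
    refine ⟨⟨h0, h.trans (Nat.div_le_self n m)⟩, ?_⟩
    rw [Nat.le_div_iff_mul_le h0]
    rw [Nat.le_div_iff_mul_le hm] at h
    linarith
  · rintro ⟨⟨h0, _⟩, h⟩
    refine ⟨h0, ?_⟩
    rw [Nat.le_div_iff_mul_le h0] at h
    rw [Nat.le_div_iff_mul_le hm]
    linarith

/-- A pointwise inequality between a combination of floors and a combination of threshold
indicators gives an inequality between log-factorials and values of `ψ`. -/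
theorem combination_log_factorial_le {W V : List (ℕ × ℤ)} (hV : ∀ p ∈ V, 0 < p.1)
    (h : ∀ z : ℕ, combination W (fun d ↦ ((z / d : ℕ) : ℤ)) ≤
      combination V (fun m ↦ if m ≤ z then 1 else 0)) (n : ℕ) :
    combination W (fun d ↦ log (n / d)!) ≤ combination V (fun m ↦ ψ (n / m : ℕ)) := by
  rw [combination_congr (W := V) (g := fun m ↦ ∑ k ∈ Ioc 0 n,
    Λ k * ((if m ≤ n / k then 1 else 0 : ℤ) : ℤ)) fun p hp ↦ psi_div_eq_sum (hV p hp)]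
  simp only [log_factorial_div_eq_sum]
  rw [combination_sum_mul W _ _ fun k d ↦ ((n / k / d : ℕ) : ℤ),
    combination_sum_mul V _ _ fun k m ↦ if m ≤ n / k then 1 else 0]
  gcongr
  exact h _

theorem combination_floor_add {W : List (ℕ × ℤ)} {L : ℕ} (hW : ∀ p ∈ W, p.1 ∣ L)
    (h0 : combination W (fun d ↦ ((L / d : ℕ) : ℤ)) = 0) (z : ℕ) :
    combination W (fun d ↦ (((z + L) / d : ℕ) : ℤ)) =
      combination W (fun d ↦ ((z / d : ℕ) : ℤ)) := by
  rw [← add_zero (combination W fun d ↦ ((z / d : ℕ) : ℤ)), ← h0, ← combination_add]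
  refine combination_congr fun p hp ↦ ?_
  rw [Nat.add_div_of_dvd_left (hW p hp)]
  push_cast
  rfl

theorem combination_floor_le_of_periodic {W V : List (ℕ × ℤ)} {L T : ℕ}
    (hL : 0 < L) (hW : ∀ p ∈ W, p.1 ∣ L) (hV : ∀ p ∈ V, p.1 ≤ T)
    (h0 : combination W (fun d ↦ ((L / d : ℕ) : ℤ)) = 0)
    (h : ∀ z < L + T, combination W (fun d ↦ ((z / d : ℕ) : ℤ)) ≤
      combination V (fun m ↦ if m ≤ z then 1 else 0)) (z : ℕ) :
    combination W (fun d ↦ ((z / d : ℕ) : ℤ)) ≤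
      combination V (fun m ↦ if m ≤ z then 1 else 0) := by
  induction z using Nat.strong_induction_on with
  | _ z ih =>
    rcases lt_or_ge z (L + T) with hz | hz
    · exact h z hz
    · obtain ⟨y, rfl⟩ : ∃ y, z = y + L := ⟨z - L, by omega⟩
      rw [combination_floor_add hW h0]
      refine (ih y (by omega)).trans_eq (combination_congr fun p hp ↦ ?_)
      have := hV p hp
      rw [if_pos (by omega), if_pos (by omega)]

theorem mul_log_sub_self_le {x y : ℝ} (hx : 0 < x) (hy : 0 < y) :
    x * log x - x + (y - x) * log x ≤ y * log y - y := by
  have h := log_le_sub_one_of_pos (div_pos hx hy)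
  rw [log_div hx.ne' hy.ne'] at h
  have h' : y * (log x - log y) ≤ x - y := by
    calc y * (log x - log y) ≤ y * (x / y - 1) := by gcongr
      _ = x - y := by field_simp
  linarith

theorem mul_log_sub_self_le_log_factorial (m : ℕ) :
    m * log m - m ≤ log m ! := by
  induction m with
  | zero => simp
  | succ m ih =>
    rcases m.eq_zero_or_pos with rfl | hm
    · simp
    have hm' : (0 : ℝ) < m := by exact_mod_cast hm
    have h := mul_log_sub_self_le (x := (m + 1 : ℝ)) (y := m) (by positivity) hm'
    rw [Nat.factorial_succ, Nat.cast_mul, log_mul (by positivity) (by positivity)]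
    push_cast
    linarith

theorem log_factorial_le {m : ℕ} (hm : 0 < m) :
    log m ! ≤ m * log m - m + log m + 1 := by
  induction m, hm using Nat.le_induction with
  | base => simp
  | succ m hm ih =>
    have hm' : (0 : ℝ) < m := by exact_mod_cast hm
    have h := mul_log_sub_self_le (x := (m : ℝ)) (y := m + 1) hm' (by positivity)
    rw [Nat.factorial_succ, Nat.cast_mul, log_mul (by positivity) (by positivity)]
    push_cast
    linarith

theorem abs_log_factorial_div_sub_le {n d : ℕ} (hn : 0 < n) (hd : 0 < d) :
    |log (n / d)! - ((n / d : ℝ) * log (n / d : ℝ) - n / d)| ≤ log n + 1 := by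
  have hn' : (1 : ℝ) ≤ n := by exact_mod_cast hn
  have hd' : (1 : ℝ) ≤ d := by exact_mod_cast hd
  have hlog : 0 ≤ log n := log_nonneg hn'
  set x : ℝ := n / d with hx
  have hx0 : 0 < x := by positivity
  have hxn : x ≤ n := div_le_self (by positivity) hd'
  have hfloor : n / d = ⌊x⌋₊ := (Nat.floor_div_eq_div n d).symm
  rw [hfloor]
  rcases lt_or_ge x 1 with h1 | h1
  · rw [Nat.floor_eq_zero.mpr h1]
    have h := mul_log_sub_self_le (x := 1) one_pos hx0
    have h' := log_nonpos hx0.le h1.le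
    simp only [log_one, mul_zero, add_zero] at h
    simp only [Nat.factorial_zero, Nat.cast_one, log_one]
    rw [abs_le]
    constructor <;> nlinarith
  · set m := ⌊x⌋₊ with hm
    have hmx : (m : ℝ) ≤ x := Nat.floor_le hx0.le
    have hxm : x < m + 1 := Nat.lt_floor_add_one x
    have hm1 : 0 < m := Nat.floor_pos.mpr h1
    have hm1' : (1 : ℝ) ≤ m := by exact_mod_cast hm1
    have hup := log_factorial_le hm1
    have hlo := mul_log_sub_self_le_log_factorial (m + 1)
    rw [Nat.factorial_succ, Nat.cast_mul, log_mul (by positivity) (by positivity)] at hlo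
    push_cast at hlo
    have h2 := mul_log_sub_self_le (x := (m : ℝ)) (y := x) (by positivity) hx0
    have h3 := mul_log_sub_self_le (x := x) (y := m + 1) hx0 (by positivity)
    have h4 : log m ≤ log n := log_le_log (by positivity) (hmx.trans hxn)
    have h5 : log (m + 1) ≤ log n + 1 := by
      have := log_le_sub_one_of_pos (x := ((m + 1) / m : ℝ)) (by positivity)
      rw [log_div (by positivity) (by positivity)] at this
      have h6 : ((m + 1) / m : ℝ) - 1 ≤ 1 := by
        rw [add_div, div_self (by positivity)]
        have : (1 / m : ℝ) ≤ 1 := (div_le_one (by positivity)).mpr hm1'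
        linarith
      linarith
    have h7 : 0 ≤ (x - m) * log m := mul_nonneg (by linarith) (log_nonneg hm1')
    have h8 : 0 ≤ (m + 1 - x) * log x := mul_nonneg (by linarith) (log_nonneg h1)
    rw [abs_le]
    constructor <;> linarith

theorem abs_combination_log_factorial_sub_le (W : List (ℕ × ℤ)) (hW : ∀ p ∈ W, 0 < p.1) {n : ℕ}
    (hn : 0 < n) :
    |combination W (fun d ↦ log (n / d)!) -
        (n * combination W (fun d ↦ -log d / d) +
          (n * log n - n) * combination W (fun d ↦ (1 / d : ℝ)))| ≤
      (W.map fun p ↦ |(p.2 : ℝ)|).sum * (log n + 1) := by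
  induction W with
  | nil => simp
  | cons p W ih =>
    have hd := hW p (by simp)
    have hn' : (0 : ℝ) < n := by exact_mod_cast hn
    have hd' : (0 : ℝ) < p.1 := by exact_mod_cast hd
    have h1 := ih fun q hq ↦ hW q (by simp [hq])
    have h2 := abs_log_factorial_div_sub_le hn hd
    rw [log_div hn'.ne' hd'.ne'] at h2
    have h3 := mul_le_mul_of_nonneg_left h2 (abs_nonneg (p.2 : ℝ))
    rw [← abs_mul] at h3
    simp only [combination_cons, List.map_cons, List.sum_cons]
    refine le_trans (le_of_eq_of_le ?_ (abs_add_le _ _)) (le_of_le_of_eq (add_le_add h3 h1) ?_)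
    · congr 1
      field_simp
      ring
    · ring

/-- The linear inequality between values of `ψ` produced by integer weights `W`, all of whose
moduli divide `L`, when the associated floor function is dominated by the thresholds `V`. -/
theorem mul_sub_le_combination_psi {W V : List (ℕ × ℤ)} {L T : ℕ} (hL : 0 < L)
    (hW : ∀ p ∈ W, p.1 ∣ L) (hV : ∀ p ∈ V, 0 < p.1 ∧ p.1 ≤ T)
    (h0 : combination W (fun d ↦ ((L / d : ℕ) : ℤ)) = 0)
    (h : ∀ z < L + T, combination W (fun d ↦ ((z / d : ℕ) : ℤ)) ≤
      combination V (fun m ↦ if m ≤ z then 1 else 0)) {n : ℕ} (hn : 0 < n) :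
    n * combination W (fun d ↦ -log d / d) - (W.map fun p ↦ |(p.2 : ℝ)|).sum * (log n + 1) ≤
      combination V (fun m ↦ ψ (n / m : ℕ)) := by
  have hW0 : ∀ p ∈ W, 0 < p.1 := fun p hp ↦ Nat.pos_of_dvd_of_pos (hW p hp) hL
  have hinv : combination W (fun d ↦ (1 / d : ℝ)) = 0 := by
    have h1 : (L : ℝ) * combination W (fun d ↦ (1 / d : ℝ)) =
        (combination W (fun d ↦ ((L / d : ℕ) : ℤ)) : ℤ) := by
      clear h0 h
      induction W with
      | nil => simp
      | cons p W ih =>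
        have hd : (p.1 : ℝ) ≠ 0 := by exact_mod_cast (hW0 p (by simp)).ne'
        simp only [combination_cons, mul_add, ih (fun q hq ↦ hW q (by simp [hq]))
          (fun q hq ↦ hW0 q (by simp [hq]))]
        rw [Int.cast_add, Int.cast_mul, Int.cast_id, Int.cast_natCast,
          Nat.cast_div (hW p (by simp)) hd]
        ring
    rw [h0, Int.cast_zero] at h1
    exact (mul_eq_zero.mp h1).resolve_left (by positivity)
  have h2 := (abs_le.mp (abs_combination_log_factorial_sub_le W hW0 hn)).1
  rw [hinv] at h2
  have h3 := combination_log_factorial_le (fun p hp ↦ (hV p hp).1)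
    (combination_floor_le_of_periodic hL hW (fun p hp ↦ (hV p hp).2) h0 h) n
  linarith

theorem four_mul_log_seven :
    4 * log 7 = 5 * log 2 + log 3 + 2 * log 5 + log (2401 / 2400) := by
  have h : (7 : ℝ) ^ 4 = 2 ^ 5 * 3 * 5 ^ 2 * (2401 / 2400) := by norm_num
  have h' := congrArg log h
  rw [log_mul (by norm_num) (by norm_num), log_mul (by norm_num) (by norm_num),
    log_mul (by norm_num) (by norm_num), log_pow, log_pow, log_pow] at h'
  exact_mod_cast h'

theorem log_seven_gt : (1.94591 : ℝ) < log 7 := by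
  have h := one_sub_inv_le_log_of_pos (x := (2401 / 2400 : ℝ)) (by norm_num)
  norm_num at h
  linarith [four_mul_log_seven, log_two_gt_d9, log_three_gt_d9, log_five_gt_d9]

theorem log_seven_lt : log 7 < (1.945911 : ℝ) := by
  have h := log_le_sub_one_of_pos (x := (2401 / 2400 : ℝ)) (by norm_num)
  norm_num at h
  linarith [four_mul_log_seven, log_two_lt_d9, log_three_lt_d9, log_five_lt_d9]

theorem log_smooth (a b c d : ℕ) :
    log (2 ^ a * 3 ^ b * 5 ^ c * 7 ^ d : ℝ) = a * log 2 + b * log 3 + c * log 5 + d * log 7 := by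
  rw [log_mul (by positivity) (by positivity), log_mul (by positivity) (by positivity),
    log_mul (by positivity) (by positivity), log_pow, log_pow, log_pow, log_pow]

/-- Weights whose floor combination is at most `-4` times the indicator of `1 ≤ z`, up to
corrections starting at `36` and `96`; they bound `ψ` from above. -/
def upperWeights : List (ℕ × ℤ) :=
  [(1, -4), (2, 4), (3, 4), (5, 4), (6, -4), (7, 4), (10, -4), (12, 4), (14, -1), (15, -3),
   (18, 4), (20, 1), (21, -1), (28, -3), (30, 5), (36, -4), (42, 5), (45, 3), (60, -3), (63, 1),
   (70, 1), (84, -1), (90, -4), (105, 1), (126, -1), (140, 1), (180, 3), (210, -3), (252, 1),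
   (1260, 3)]

/-- Weights whose floor combination is at most the indicator of `1 ≤ z`, up to corrections starting
at `13`, `17` and `179`; they bound `ψ` from below. -/
def lowerWeights : List (ℕ × ℤ) :=
  [(1, 1), (2, -1), (3, -1), (5, -1), (6, 1), (7, -1), (14, 1), (15, 1), (18, -1), (21, 1),
   (28, -1), (30, -1), (35, 1), (42, -2), (45, -1), (60, 1), (63, -1), (70, -2), (84, 1),
   (90, 1), (105, -2), (126, 1), (140, 1), (180, -1), (210, 2), (252, -1), (420, -1), (1260, 1)]

theorem upper_gain : -4.1502 ≤ combination upperWeights (fun d ↦ -log d / d) := by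
  have h6 := log_smooth 1 1 0 0
  have h10 := log_smooth 1 0 1 0
  have h12 := log_smooth 2 1 0 0
  have h14 := log_smooth 1 0 0 1
  have h15 := log_smooth 0 1 1 0
  have h18 := log_smooth 1 2 0 0
  have h20 := log_smooth 2 0 1 0
  have h21 := log_smooth 0 1 0 1
  have h28 := log_smooth 2 0 0 1
  have h30 := log_smooth 1 1 1 0
  have h36 := log_smooth 2 2 0 0
  have h42 := log_smooth 1 1 0 1
  have h45 := log_smooth 0 2 1 0
  have h60 := log_smooth 2 1 1 0
  have h63 := log_smooth 0 2 0 1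
  have h70 := log_smooth 1 0 1 1
  have h84 := log_smooth 2 1 0 1
  have h90 := log_smooth 1 2 1 0
  have h105 := log_smooth 0 1 1 1
  have h126 := log_smooth 1 2 0 1
  have h140 := log_smooth 2 0 1 1
  have h180 := log_smooth 2 2 1 0
  have h210 := log_smooth 1 1 1 1
  have h252 := log_smooth 2 2 0 1
  have h1260 := log_smooth 2 2 1 1
  norm_num at h6 h10 h12 h14 h15 h18 h20 h21 h28 h30 h36 h42 h45 h60 h63 h70 h84 h90 h105 h126
  norm_num at h140 h180 h210 h252 h1260
  simp only [upperWeights, combination_cons, combination_nil]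
  norm_num
  simp only [h6, h10, h12, h14, h15, h18, h20, h21, h28, h30, h36, h42, h45, h60, h63, h70, h84,
    h90, h105, h126, h140, h180, h210, h252, h1260]
  linarith [log_two_gt_d9, log_two_lt_d9, log_three_gt_d9, log_three_lt_d9, log_five_gt_d9,
    log_five_lt_d9, log_seven_gt, log_seven_lt]

theorem lower_gain : 1.093673 ≤ combination lowerWeights (fun d ↦ -log d / d) := by
  have h6 := log_smooth 1 1 0 0
  have h14 := log_smooth 1 0 0 1
  have h15 := log_smooth 0 1 1 0
  have h18 := log_smooth 1 2 0 0
  have h21 := log_smooth 0 1 0 1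
  have h28 := log_smooth 2 0 0 1
  have h30 := log_smooth 1 1 1 0
  have h35 := log_smooth 0 0 1 1
  have h42 := log_smooth 1 1 0 1
  have h45 := log_smooth 0 2 1 0
  have h60 := log_smooth 2 1 1 0
  have h63 := log_smooth 0 2 0 1
  have h70 := log_smooth 1 0 1 1
  have h84 := log_smooth 2 1 0 1
  have h90 := log_smooth 1 2 1 0
  have h105 := log_smooth 0 1 1 1
  have h126 := log_smooth 1 2 0 1
  have h140 := log_smooth 2 0 1 1
  have h180 := log_smooth 2 2 1 0
  have h210 := log_smooth 1 1 1 1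
  have h252 := log_smooth 2 2 0 1
  have h420 := log_smooth 2 1 1 1
  have h1260 := log_smooth 2 2 1 1
  norm_num at h6 h14 h15 h18 h21 h28 h30 h35 h42 h45 h60 h63 h70 h84 h90 h105 h126 h140 h180 h210
  norm_num at h252 h420 h1260
  simp only [lowerWeights, combination_cons, combination_nil]
  norm_num
  simp only [h6, h14, h15, h18, h21, h28, h30, h35, h42, h45, h60, h63, h70, h84, h90, h105,
    h126, h140, h180, h210, h252, h420, h1260]
  linarith [log_two_gt_d9, log_two_lt_d9, log_three_gt_d9, log_three_lt_d9, log_five_gt_d9,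
    log_five_lt_d9, log_seven_gt, log_seven_lt]

theorem combination_int_eq_foldr (W : List (ℕ × ℤ)) (f : ℕ → ℤ) :
    combination W f = W.foldr (fun p a ↦ Int.add (Int.mul p.2 (f p.1)) a) 0 := by
  induction W with
  | nil => rfl
  | cons p W ih => rw [combination_cons, ih]; rfl

theorem upper_floor : ∀ z < 1260 + 96, combination upperWeights (fun d ↦ ((z / d : ℕ) : ℤ)) ≤
    combination [(1, -4), (36, 2), (96, 2)] (fun m ↦ if m ≤ z then 1 else 0) := by
  simp only [combination_int_eq_foldr]
  decide +kernel

theorem lower_floor : ∀ z < 1260 + 179, combination lowerWeights (fun d ↦ ((z / d : ℕ) : ℤ)) ≤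
    combination [(1, 1), (13, 1), (17, 1), (179, 1)] (fun m ↦ if m ≤ z then 1 else 0) := by
  simp only [combination_int_eq_foldr]
  decide +kernel

theorem upper_inequality {n : ℕ} (hn : 0 < n) :
    4 * ψ n ≤ 4.1502 * n + 85 * (log n + 1) + 2 * ψ (n / 36 : ℕ) + 2 * ψ (n / 96 : ℕ) := by
  have h := mul_sub_le_combination_psi (by norm_num) (by decide) (by decide) (by decide)
    upper_floor hn
  have h' := mul_le_mul_of_nonneg_left upper_gain (Nat.cast_nonneg (α := ℝ) n)
  have hs : (upperWeights.map fun p ↦ |(p.2 : ℝ)|).sum = 85 := by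
    norm_num [upperWeights]
  rw [hs] at h
  simp only [combination_cons, combination_nil, Nat.div_one] at h
  push_cast at h
  linarith

theorem lower_inequality {n : ℕ} (hn : 0 < n) :
    1.093673 * n - 32 * (log n + 1) ≤
      ψ n + ψ (n / 13 : ℕ) + ψ (n / 17 : ℕ) + ψ (n / 179 : ℕ) := by
  have h := mul_sub_le_combination_psi (by norm_num) (by decide) (by decide) (by decide)
    lower_floor hn
  have h' := mul_le_mul_of_nonneg_left lower_gain (Nat.cast_nonneg (α := ℝ) n)
  have hs : (lowerWeights.map fun p ↦ |(p.2 : ℝ)|).sum = 32 := by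
    norm_num [lowerWeights]
  rw [hs] at h
  simp only [combination_cons, combination_nil, Nat.div_one] at h
  push_cast at h
  linarith

theorem log_natDiv_le {n k : ℕ} (hk : 36 ≤ k) (hn : 36 ≤ n) :
    log (n / k : ℕ) ≤ log n - 3 := by
  have h36 : (3 : ℝ) ≤ log 36 := by
    have h : log (36 : ℝ) = 2 * log 2 + 2 * log 3 := by
      rw [show (36 : ℝ) = 2 ^ 2 * 3 ^ 2 by norm_num, log_mul (by norm_num) (by norm_num),
        log_pow, log_pow]
      norm_num
    linarith [log_two_gt_d9, log_three_gt_d9]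
  have hn' : log 36 ≤ log n := log_le_log (by norm_num) (by exact_mod_cast hn)
  rcases Nat.eq_zero_or_pos (n / k) with h0 | h0
  · rw [h0]
    simp only [Nat.cast_zero, log_zero]
    linarith
  · have h1 : ((n / k : ℕ) : ℝ) * 36 ≤ n := by
      exact_mod_cast (Nat.mul_le_mul_left _ hk).trans (Nat.div_mul_le_self n k)
    have h2 := log_le_log (by positivity) h1
    rw [log_mul (by positivity) (by norm_num)] at h2
    linarith

theorem psi_natCast_le (n : ℕ) : ψ n ≤ 1.058 * n + 6 * (log n + 1) ^ 2 + 19 := by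
  induction n using Nat.strong_induction_on with
  | _ n ih =>
    rcases n.eq_zero_or_pos with rfl | hn
    · simp
      norm_num
    have hlog : 0 ≤ log n := log_natCast_nonneg n
    have hup := upper_inequality hn
    have hn' : (0 : ℝ) < n := by exact_mod_cast hn
    rcases lt_or_ge n 36 with h36 | h36
    · rw [Nat.div_eq_of_lt h36, Nat.div_eq_of_lt (by omega)] at hup
      simp only [Nat.cast_zero, Chebyshev.psi_zero] at hup
      nlinarith [sq_nonneg (48 * (log n + 1) - 85)]
    · have key (k : ℕ) (hk : 36 ≤ k) :
          ψ (n / k : ℕ) ≤ 1.058 * (n / k) + 6 * (log n - 2) ^ 2 + 19 := by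
        have h1 := ih (n / k) (Nat.div_lt_self hn (by omega))
        have h2 := log_natDiv_le hk h36
        have h3 : ((n / k : ℕ) : ℝ) ≤ n / k := Nat.cast_div_le
        have h4 := log_natCast_nonneg (n / k)
        have h5 : (log (n / k : ℕ) + 1) ^ 2 ≤ (log n - 2) ^ 2 := by
          gcongr
          linarith
        linarith
      have h1 := key 36 le_rfl
      have h2 := key 96 (by norm_num)
      have h3 : 3 ≤ log n := by
        have := log_natDiv_le (le_refl 36) h36
        have := log_natCast_nonneg (n / 36)
        linarith
      push_cast at h1 h2
      nlinarith

theorem le_psi_natCast {n : ℕ} (hn : 0 < n) :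
    0.94414 * n - 32 * (log n + 1) - 18 * (log n + 1) ^ 2 - 57 ≤ ψ n := by
  have key (k : ℕ) : ψ (n / k : ℕ) ≤ 1.058 * (n / k) + 6 * (log n + 1) ^ 2 + 19 := by
    have h1 := psi_natCast_le (n / k)
    have h3 : ((n / k : ℕ) : ℝ) ≤ n / k := Nat.cast_div_le
    have h4 := log_natCast_nonneg (n / k)
    have h5 : log (n / k : ℕ) ≤ log n := by
      rcases Nat.eq_zero_or_pos (n / k) with h0 | h0
      · rw [h0]
        simpa using log_natCast_nonneg n
      · exact log_le_log (by exact_mod_cast h0) (by exact_mod_cast Nat.div_le_self n k)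
    have h6 : (log (n / k : ℕ) + 1) ^ 2 ≤ (log n + 1) ^ 2 := by gcongr
    linarith
  have h1 := key 13
  have h2 := key 17
  have h3 := key 179
  have h4 := lower_inequality hn
  have hn' : (0 : ℝ) < n := by exact_mod_cast hn
  push_cast at h1 h2 h3
  linarith

theorem theta_eq_of_forall_not_prime {n m : ℕ} (hnm : n ≤ m)
    (h : ∀ p, n < p → p ≤ m → ¬ p.Prime) : θ m = θ n := by
  rw [Chebyshev.theta, Chebyshev.theta, Nat.floor_natCast, Nat.floor_natCast]
  refine sum_congr ?_ fun _ _ ↦ rfl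
  ext p
  simp only [mem_filter, mem_Ioc]
  constructor
  · rintro ⟨⟨h0, hp⟩, hprime⟩
    exact ⟨⟨h0, not_lt.mp fun hlt ↦ h p hlt hp hprime⟩, hprime⟩
  · rintro ⟨⟨h0, hp⟩, hprime⟩
    exact ⟨⟨h0, hp.trans hnm⟩, hprime⟩

theorem psi_sub_theta_le_three_mul {m : ℕ} (hm : 0 < m) :
    ψ m - θ m ≤ 3 * (1.058 * √m + 6 * (log m + 1) ^ 2 + 19) := by
  have hm' : (1 : ℝ) ≤ m := by exact_mod_cast hm
  have hroot : (m : ℝ) ^ (2 : ℝ)⁻¹ = √m := by rw [sqrt_eq_rpow, one_div]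
  have h3 : ψ ((m : ℝ) ^ (3 : ℝ)⁻¹) ≤ ψ √m := by
    rw [← hroot]
    exact Chebyshev.psi_mono (rpow_le_rpow_of_exponent_le hm' (by norm_num))
  have h5 : ψ ((m : ℝ) ^ (5 : ℝ)⁻¹) ≤ ψ √m := by
    rw [← hroot]
    exact Chebyshev.psi_mono (rpow_le_rpow_of_exponent_le hm' (by norm_num))
  have h := Chebyshev.psi_sub_theta_le_psi_add_psi_add_psi m
  rw [hroot] at h
  have hs : (1 : ℝ) ≤ √m := one_le_sqrt.mpr hm'
  have hs' : √m ≤ m := (sqrt_le_left (by positivity)).mpr (le_self_pow₀ hm' two_ne_zero)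
  have hr : (⌊√(m : ℝ)⌋₊ : ℝ) ≤ √m := Nat.floor_le (sqrt_nonneg _)
  have hr0 : (0 : ℝ) < ⌊√(m : ℝ)⌋₊ := by exact_mod_cast Nat.floor_pos.mpr hs
  have hψ : ψ √m ≤ 1.058 * √m + 6 * (log m + 1) ^ 2 + 19 := by
    rw [Chebyshev.psi_eq_psi_coe_floor]
    refine (psi_natCast_le _).trans ?_
    have hl := log_natCast_nonneg ⌊√(m : ℝ)⌋₊
    gcongr
    exact_mod_cast hr.trans hs'
  linarith

theorem exists_prime_of_large {n : ℕ} (hn : 10 ^ 7 ≤ n) :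
    ∃ p : ℕ, p.Prime ∧ n < p ∧ 8 * p ≤ 9 * n := by
  by_contra! hno
  obtain ⟨m, hm⟩ : ∃ m, m = 9 * n / 8 := ⟨_, rfl⟩
  have hm8 : 8 * m ≤ 9 * n := by omega
  have hm9 : 9 * n < 8 * m + 8 := by omega
  have hθ : θ m = θ n := theta_eq_of_forall_not_prime (by omega) fun p hnp hpm hp ↦ by
    have := hno p hp hnp
    omega
  have hnR : (10 : ℝ) ^ 7 ≤ n := by exact_mod_cast hn
  have hm8R : (8 : ℝ) * m ≤ 9 * n := by exact_mod_cast hm8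
  have hm9R : (9 : ℝ) * n < 8 * m + 8 := by exact_mod_cast hm9
  have hm0 : (0 : ℝ) < m := by linarith
  have hn0 : (0 : ℝ) < n := by linarith
  obtain ⟨s, hs0, hs⟩ : ∃ s : ℝ, 0 ≤ s ∧ s ^ 4 = n :=
    ⟨√√n, by positivity, by
      rw [show (4 : ℕ) = 2 * 2 by norm_num, pow_mul, sq_sqrt (by positivity),
        sq_sqrt (by positivity)]⟩
  have hs56 : 56 ≤ s := by
    by_contra! hlt
    have := pow_lt_pow_left₀ hlt hs0 (n := 4) (by norm_num)
    linarith
  have hlogs : log s ≤ s / 56 + 3.03 := by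
    have h1 := log_le_sub_one_of_pos (x := s / 56) (by positivity)
    rw [log_div (by positivity) (by norm_num)] at h1
    have h2 : log (56 : ℝ) = 3 * log 2 + log 7 := by
      rw [show (56 : ℝ) = 2 ^ 3 * 7 by norm_num, log_mul (by norm_num) (by norm_num), log_pow]
      norm_num
    linarith [log_two_lt_d9, log_seven_lt]
  have hlogn : log n = 4 * log s := by
    rw [← hs, log_pow]
    norm_num
  have hlogm : log m ≤ log n + 0.125 := by
    have h1 := log_le_sub_one_of_pos (x := (m / n : ℝ)) (by positivity)
    rw [log_div hm0.ne' hn0.ne'] at h1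
    have h2 : (m / n : ℝ) ≤ 1.125 := by
      rw [div_le_iff₀ hn0]
      linarith
    linarith
  have hlogm0 := log_natCast_nonneg m
  have hlogn0 := log_natCast_nonneg n
  set K : ℝ := s / 14 + 13.25 with hK
  have hKm : log m + 1 ≤ K := by linarith
  have hKn : log n + 1 ≤ K := by linarith
  have hKm2 : (log m + 1) ^ 2 ≤ K ^ 2 := by gcongr
  have hKn2 : (log n + 1) ^ 2 ≤ K ^ 2 := by gcongr
  have hsqrt : √m ≤ 1.07 * s ^ 2 := by
    rw [sqrt_le_left (by positivity)]
    nlinarith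
  have h1 := le_psi_natCast (n := m) (by exact_mod_cast hm0)
  have h2 := psi_natCast_le n
  have h3 := psi_sub_theta_le_three_mul (m := m) (by exact_mod_cast hm0)
  have h4 := Chebyshev.theta_le_psi n
  have h5 : 0.0041 * s ^ 4 ≤ 134 + 32 * K + 42 * K ^ 2 + 3.4 * s ^ 2 := by
    rw [hs]
    nlinarith
  have h6 : 3136 * s ^ 2 ≤ s ^ 4 := by nlinarith
  rw [hK] at h5
  nlinarith

theorem exists_prime_of_isChain {a n : ℕ} {l : List ℕ} (hl : ∀ p ∈ l, p.Prime)
    (hc : (a :: l).IsChain fun q r ↦ 8 * r < 9 * q + 63) (han : a ≤ n)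
    (hn : n < (a :: l).getLast (by simp)) :
    ∃ p : ℕ, p.Prime ∧ n < p ∧ 8 * p < 9 * n + 63 := by
  induction l generalizing a with
  | nil => simp at hn; omega
  | cons b l ih =>
    rw [List.isChain_cons_cons] at hc
    rcases lt_or_ge n b with h | h
    · exact ⟨b, hl b (by simp), h, by omega⟩
    · exact ih (fun p hp ↦ hl p (by simp [hp])) hc.2 h (by simpa using hn)

/-- Primes each of which is less than `(9 * q + 63) / 8`, where `q` is the preceding one. -/
def chainPrimes : List ℕ :=
  [7, 13, 19, 29, 37, 47, 59, 73, 89, 107, 127, 149, 173, 199, 229, 263, 293, 337, 383, 433, 491,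
   557, 631, 709, 797, 887, 997, 1129, 1277, 1439, 1621, 1831, 2063, 2311, 2593, 2917, 3271,
   3677, 4139, 4663, 5237, 5897, 6637, 7459, 8389, 9439, 10613, 11941, 13441, 15121, 17011,
   19141, 21529, 24223, 27253, 30661, 34501, 38821, 43669, 49123, 55259, 62171, 69941, 78691,
   88523, 99581, 112031, 126041, 141803, 159521, 179461, 201893, 227131, 255523, 287449, 323383,
   363809, 409291, 460451, 517999, 582737, 655583, 737537, 829733, 933433, 1050083, 1181329,
   1328981, 1495097, 1681991, 1892239, 2128769, 2394871, 2694221, 3031001, 3409853, 3836069,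
   4315579, 4855033, 5461919, 6144653, 6912733, 7776799, 8748893, 9842509, 11072819]

theorem prime_of_mem_chainPrimes : ∀ p ∈ chainPrimes, p.Prime := by
  simp only [chainPrimes, List.forall_mem_cons, List.not_mem_nil, false_imp_iff, implies_true,
    and_true]
  norm_num

theorem exists_prime_of_small {n : ℕ} (hn : 0 < n) (hn' : n < 10 ^ 7) :
    ∃ p : ℕ, p.Prime ∧ n < p ∧ 8 * p < 9 * n + 63 :=
  exists_prime_of_isChain prime_of_mem_chainPrimes (a := 1) (by decide +kernel) hn
    (hn'.trans (by decide +kernel))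

theorem stmt_3 (n : ℕ) (hn : 0 < n) :
    ∃ p : ℕ, p.Prime ∧ (n : ℚ) < p ∧ (p : ℚ) < (9 * n + 63) / 8 := by
  obtain ⟨p, hp, hnp, hpn⟩ : ∃ p : ℕ, p.Prime ∧ n < p ∧ 8 * p < 9 * n + 63 := by
    rcases lt_or_ge n (10 ^ 7) with h | h
    · exact exists_prime_of_small hn h
    · obtain ⟨p, hp, hnp, hpn⟩ := exists_prime_of_large h
      exact ⟨p, hp, hnp, by omega⟩
  refine ⟨p, hp, by exact_mod_cast hnp, ?_⟩
  rw [lt_div_iff₀ (by norm_num)]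
  exact_mod_cast (mul_comm p 8).trans_lt hpn
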